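/- Let E be the exterior algebra on n variables over an infinite field and P_n the path graph on n vertices. If n is not congruent to 1 modulo 3, then E/I_E(P_n) has no regular linear form, i.e., every degree-1 element of E is singular on E/I_E(P_n). -/

import Mathlib

open ExteriorAlgebra

noncomputable instance instModuleExtSelf (K : Type*) [Field K] (V : Type*) [AddCommGroup V]
    [Module K V] : Module (ExteriorAlgebra K V) (ExteriorAlgebra K V) := Semiring.toModule

/-- The edge ideal of a simple graph `G` in the exterior algebra on its vertex set. -/
noncomputable def edgeIdeal (K : Type*) [Field K] {α : Type*} [DecidableEq α]
    (G : SimpleGraph α) : Ideal (ExteriorAlgebra K (α → K)) :=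
  Ideal.span {x | ∃ i j, G.Adj i j ∧
      x = ExteriorAlgebra.ι K (Pi.single i 1) * ExteriorAlgebra.ι K (Pi.single j 1)}

theorem trace_zero {K M : Type*} [Field K] [AddCommGroup M] [Module K M] [FiniteDimensional K M]
    (T σ : M →ₗ[K] M) (hσ : σ ∘ₗ T = - (T ∘ₗ σ)) (hT : ∀ x, T x = 0 ↔ ∃ y, T y = x) :
    LinearMap.trace K M σ = 0 := by
  obtain ⟨g, hg⟩ := LinearMap.exists_rightInverse_of_surjective T.rangeRestrict
    (LinearMap.range_eq_top.2 T.surjective_rangeRestrict)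
  obtain ⟨h, hh⟩ := LinearMap.exists_extend g
  have hTh : ∀ x, T (h (T x)) = T x := by
    intro x
    have h1 : h (T x) = g (T.rangeRestrict x) := by rw [← hh]; rfl
    have h2 := LinearMap.congr_fun hg (T.rangeRestrict x)
    rw [h1]
    exact congrArg Subtype.val h2
  have hTT : ∀ x, T (T x) = 0 := fun x => (hT _).2 ⟨x, rfl⟩
  have hs : ∀ x, σ (T x) = - T (σ x) := fun x => LinearMap.congr_fun hσ x
  have key : ∀ x, x = T (h x) + h (T x) - T (h (h (T x))) := by
    intro x
    obtain ⟨y, hy⟩ := (hT (x - h (T x))).1 (by rw [map_sub, hTh, sub_self])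
    have := hTh y
    rw [hy, map_sub, map_sub] at this
    rw [eq_sub_iff_add_eq'] at this
    conv_lhs => rw [← this]
    abel
  have e : σ = (σ ∘ₗ T) ∘ₗ h + (σ ∘ₗ h) ∘ₗ T - (σ ∘ₗ T) ∘ₗ (h ∘ₗ h ∘ₗ T) := by
    ext x
    conv_lhs => rw [key x]
    simp
  have t1 : LinearMap.trace K M ((σ ∘ₗ h) ∘ₗ T) = LinearMap.trace K M ((T ∘ₗ σ) ∘ₗ h) := by
    rw [LinearMap.trace_comp_comm']; rfl
  have t2 : LinearMap.trace K M ((σ ∘ₗ T) ∘ₗ (h ∘ₗ h ∘ₗ T)) = 0 := by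
    have : (σ ∘ₗ T) ∘ₗ (h ∘ₗ h ∘ₗ T) = ((σ ∘ₗ T) ∘ₗ (h ∘ₗ h)) ∘ₗ T := rfl
    rw [this, LinearMap.trace_comp_comm']
    convert map_zero (LinearMap.trace K M)
    ext x
    simp [hs, hTT]
  rw [e, map_sub, map_add, t1, t2, hσ]
  simp [LinearMap.neg_comp]

def Ind (S : Finset ℕ) : Prop := ∀ i ∈ S, i + 1 ∉ S

open Classical in
noncomputable def wt (S : Finset ℕ) : ℤ := if Ind S then (-1) ^ S.card else 0

noncomputable def FF (n : ℕ) : ℤ := ∑ S ∈ (Finset.range n).powerset, wt S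

theorem FF_rec (n : ℕ) : FF (n+2) = FF (n+1) - FF n := by
  unfold FF
  rw [Finset.range_add_one, Finset.sum_powerset_insert (by simp)]
  rw [sub_eq_add_neg]
  congr 1
  rw [Finset.range_add_one, Finset.sum_powerset_insert (by simp)]
  rw [← Finset.sum_neg_distrib]
  rw [Finset.sum_eq_zero (s := (Finset.range n).powerset) (f := fun t => wt (insert (n+1) (insert n t))), add_zero]
  · apply Finset.sum_congr rfl
    intro t ht
    rw [Finset.mem_powerset] at ht
    have hlt : ∀ i ∈ t, i < n := fun i hi => Finset.mem_range.1 (ht hi)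
    have h1 : n + 1 ∉ t := fun h => by have := hlt _ h; omega
    have : Ind (insert (n+1) t) ↔ Ind t := by
      unfold Ind
      constructor
      · intro h i hi h2
        exact h i (by simp [hi]) (by simp [h2])
      · intro h i hi h2
        rw [Finset.mem_insert] at hi h2
        rcases hi with rfl | hi
        · rcases h2 with h2 | h2
          · omega
          · have := hlt _ h2; omega
        · have := hlt _ hi
          rcases h2 with h2 | h2
          · omega
          · exact h i hi h2
    unfold wt
    rw [Finset.card_insert_of_notMem h1]
    by_cases hI : Ind t
    · rw [if_pos (this.2 hI), if_pos hI]; ring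
    · rw [if_neg (fun h => hI (this.1 h)), if_neg hI]; simp
  · intro t ht
    unfold wt
    rw [if_neg]
    intro h
    exact h n (by simp) (by simp)

theorem FF_val (k : ℕ) : FF (3*k) = (-1)^k ∧ FF (3*k+1) = 0 := by
  induction k with
  | zero =>
    have h0 : wt ∅ = 1 := by simp [wt, Ind]
    have h1 : wt {0} = -1 := by simp [wt, Ind]
    constructor
    · simp [FF, h0]
    · unfold FF
      rw [Finset.range_add_one, Finset.sum_powerset_insert (by simp)]
      simp [h0, h1]
  | succ k ih =>
    have a := FF_rec (3*k)
    have b := FF_rec (3*k+1)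
    have c := FF_rec (3*k+2)
    have e1 : 3 * (k+1) = 3*k+1+2 := by ring
    have e2 : 3 * (k+1) + 1 = 3*k+2+2 := by ring
    rw [e2, e1, pow_succ]
    constructor
    · grind
    · grind

theorem FF_ne (n : ℕ) (hn : n % 3 ≠ 1) : FF n = 1 ∨ FF n = -1 := by
  obtain ⟨h1, h2⟩ := FF_val (n/3)
  have h3 := FF_rec (3 * (n/3))
  have := neg_one_pow_eq_or ℤ (n/3)
  have : n % 3 = 0 ∨ n % 3 = 2 := by omega
  rcases this with h | h
  · have e : n = 3 * (n/3) := by omega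
    rw [e]; grind
  · have e : n = 3 * (n/3) + 2 := by omega
    rw [e]; grind


section Model
variable {K : Type*} [Field K] {n : ℕ} (G : SimpleGraph (Fin n))

def GInd (S : Finset (Fin n)) : Prop := ∀ i ∈ S, ∀ j ∈ S, ¬ G.Adj i j

theorem GInd.mono {G : SimpleGraph (Fin n)} {S T : Finset (Fin n)} (h : GInd G T) (hs : S ⊆ T) :
    GInd G S := fun i hi j hj => h i (hs hi) j (hs hj)

open Classical in
noncomputable def opv (K : Type*) [Field K] (i : Fin n) (S : Finset (Fin n)) : Finset (Fin n) →₀ K :=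
  if i ∉ S ∧ GInd G (insert i S) then
    ((-1 : K) ^ (S.filter (· < i)).card) • Finsupp.single (insert i S) 1 else 0

noncomputable def op (K : Type*) [Field K] (i : Fin n) :
    (Finset (Fin n) →₀ K) →ₗ[K] (Finset (Fin n) →₀ K) :=
  Finsupp.linearCombination K (opv G K i)

theorem op_single (i : Fin n) (S : Finset (Fin n)) :
    op G K i (Finsupp.single S 1) = opv G K i S := by
  simp [op]

theorem op_sq (i : Fin n) : op G K i * op G K i = 0 := by
  ext1 S
  ext1
  simp only [LinearMap.comp_apply, Module.End.mul_apply, Finsupp.lsingle_apply, op_single]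
  unfold opv
  split_ifs
  · rw [map_smul, op_single]
    simp [opv]
  · simp

theorem op_anti_aux {i j : Fin n} (h : i < j) : op G K i * op G K j + op G K j * op G K i = 0 := by
  ext1 S
  ext1
  simp only [LinearMap.comp_apply, Module.End.mul_apply, Finsupp.lsingle_apply, op_single,
    LinearMap.add_apply]
  by_cases hc : i ∉ S ∧ j ∉ S ∧ GInd G (insert i (insert j S))
  · obtain ⟨hi, hj, hI⟩ := hc
    have hI' : GInd G (insert j (insert i S)) := by rwa [Finset.insert_comm]
    have c1 : (insert j S).filter (· < i) = S.filter (· < i) := by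
      rw [Finset.filter_insert, if_neg (by simpa using h.le)]
    have c2 : ((insert i S).filter (· < j)).card = (S.filter (· < j)).card + 1 := by
      rw [Finset.filter_insert, if_pos h, Finset.card_insert_of_notMem (by simp [hi])]
    have a1 : opv G K j S = ((-1 : K) ^ (S.filter (· < j)).card) • Finsupp.single (insert j S) 1 :=
      if_pos ⟨hj, hI.mono (Finset.subset_insert _ _)⟩
    have a2 : opv G K i S = ((-1 : K) ^ (S.filter (· < i)).card) • Finsupp.single (insert i S) 1 :=
      if_pos ⟨hi, hI'.mono (Finset.subset_insert _ _)⟩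
    have a3 : opv G K i (insert j S) = _ := if_pos ⟨by simp [hi, h.ne], hI⟩
    have a4 : opv G K j (insert i S) = _ := if_pos ⟨by simp [hj, h.ne'], hI'⟩
    rw [a1, a2, map_smul, map_smul, op_single, op_single, a3, a4, c1, c2, smul_smul, smul_smul,
      Finset.insert_comm j i, ← add_smul]
    simp only [LinearMap.zero_apply]
    convert zero_smul K _
    ring
  · have b1 : ∀ i j, (¬ (i ∉ S ∧ j ∉ S ∧ GInd G (insert i (insert j S)))) →
        op G K i (opv G K j S) = 0 := by
      intro i j hc
      unfold opv
      split_ifs with h1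
      · rw [map_smul, op_single, opv, if_neg, smul_zero]
        rintro ⟨h2, h3⟩
        exact hc ⟨fun h => h2 (by simp [h]), h1.1, h3⟩
      · simp
    rw [b1 i j hc, b1 j i, add_zero]
    · rfl
    · rintro ⟨h1, h2, h3⟩
      exact hc ⟨h2, h1, by rwa [Finset.insert_comm]⟩

theorem op_anti (i j : Fin n) : op G K i * op G K j + op G K j * op G K i = 0 := by
  rcases lt_trichotomy i j with h | rfl | h
  · exact op_anti_aux G h
  · rw [op_sq, add_zero]
  · rw [add_comm]; exact op_anti_aux G h

noncomputable def opL (K : Type*) [Field K] :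
    (Fin n → K) →ₗ[K] Module.End K (Finset (Fin n) →₀ K) :=
  Fintype.linearCombination K (op G K)

theorem opL_sq (v : Fin n → K) : opL G K v * opL G K v = 0 := by
  unfold opL
  rw [Fintype.linearCombination_apply, Finset.sum_mul_sum, ← Finset.sum_product']
  apply Finset.sum_involution (fun p _ => (p.2, p.1))
  · rintro ⟨i, j⟩ _
    simp only [smul_mul_smul_comm]
    rw [mul_comm (v j), ← smul_add, op_anti, smul_zero]
  · rintro ⟨i, j⟩ _ h1 h2
    simp only [Prod.mk.injEq] at h2
    apply h1
    rw [h2.1]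
    simp [op_sq]
  · simp
  · simp

noncomputable def act (K : Type*) [Field K] :
    ExteriorAlgebra K (Fin n → K) →ₐ[K] Module.End K (Finset (Fin n) →₀ K) :=
  ExteriorAlgebra.lift K ⟨opL G K, opL_sq G⟩

noncomputable def ee (K : Type*) [Field K] (i : Fin n) : ExteriorAlgebra K (Fin n → K) :=
  ExteriorAlgebra.ι K (Pi.single i 1)

theorem act_ee (i : Fin n) : act G K (ee K i) = op G K i := by
  unfold act ee
  rw [ExteriorAlgebra.lift_ι_apply]
  simp [opL]

theorem ee_sq (i : Fin n) : ee K i * ee K i = 0 := ExteriorAlgebra.ι_sq_zero _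

theorem ee_anti (i j : Fin n) : ee K i * ee K j = - (ee K j * ee K i) :=
  eq_neg_of_add_eq_zero_left (ExteriorAlgebra.ι_add_mul_swap _ _)

/-- monomials -/
noncomputable def mon (K : Type*) [Field K] (l : List (Fin n)) : ExteriorAlgebra K (Fin n → K) :=
  (l.map (ee K)).prod

theorem mon_cons (i : Fin n) (l : List (Fin n)) : mon K (i :: l) = ee K i * mon K l := by
  simp [mon]

theorem mon_append (l l' : List (Fin n)) : mon K (l ++ l') = mon K l * mon K l' := by
  simp [mon]

theorem mon_perm {l l' : List (Fin n)} (h : l.Perm l') :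
    mon K l = mon K l' ∨ mon K l = - mon K l' := by
  induction h with
  | nil => simp
  | cons x h ih =>
    rw [mon_cons, mon_cons]
    rcases ih with ih | ih <;> simp [ih]
  | swap x y l =>
    right
    rw [mon_cons, mon_cons, mon_cons, mon_cons, ← mul_assoc, ee_anti, neg_mul, mul_assoc]
  | trans _ _ h1 h2 =>
    rcases h1 with h1 | h1 <;> rcases h2 with h2 | h2 <;> simp [h1, h2]

noncomputable def ev (K : Type*) [Field K] :
    ExteriorAlgebra K (Fin n → K) →ₗ[K] (Finset (Fin n) →₀ K) :=
  (LinearMap.applyₗ (Finsupp.single ∅ 1)) ∘ₗ (act G K).toLinearMap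

theorem ev_apply (x : ExteriorAlgebra K (Fin n → K)) :
    ev G K x = act G K x (Finsupp.single ∅ 1) := rfl

theorem ev_mon (l : List (Fin n)) (hl : l.Nodup) (hI : GInd G l.toFinset) :
    ∃ c : K, c ≠ 0 ∧ ev G K (mon K l) = Finsupp.single l.toFinset c := by
  induction l with
  | nil => exact ⟨1, one_ne_zero, by simp [mon, ev_apply]⟩
  | cons i l ih =>
    rw [List.nodup_cons] at hl
    rw [List.toFinset_cons] at hI
    obtain ⟨c, hc, h⟩ := ih hl.2 (hI.mono (Finset.subset_insert _ _))
    refine ⟨c * (-1) ^ (l.toFinset.filter (· < i)).card, by simp [hc], ?_⟩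
    rw [mon_cons, ev_apply, map_mul, Module.End.mul_apply, ← ev_apply, h, act_ee,
      ← mul_one c, ← smul_eq_mul c 1, ← Finsupp.smul_single, map_smul, op_single, opv,
      if_pos ⟨by simp [hl.1], hI⟩]
    simp

theorem ev_edge (x : ExteriorAlgebra K (Fin n → K)) (hx : x ∈ edgeIdeal K G) : ev G K x = 0 := by
  unfold edgeIdeal at hx
  refine Submodule.span_induction ?_ ?_ ?_ ?_ hx
  · rintro _ ⟨i, j, hij, rfl⟩
    change ev G K (ee K i * ee K j) = 0
    rw [ev_apply, map_mul, Module.End.mul_apply, act_ee, act_ee, op_single, opv]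
    split_ifs
    · rw [map_smul, op_single, opv, if_neg, smul_zero]
      rintro ⟨_, h⟩
      exact h i (by simp) j (by simp) hij
    · simp
  · simp
  · intro x y _ _ h1 h2
    rw [map_add, h1, h2, add_zero]
  · intro a x _ h
    rw [smul_eq_mul, ev_apply, map_mul, Module.End.mul_apply, ← ev_apply, h, map_zero]

theorem mon_mem (S : Finset (Fin n)) (h : ¬ GInd G S) : mon K S.toList ∈ edgeIdeal K G := by
  unfold GInd at h
  push Not at h
  obtain ⟨i, hi, j, hj, hij⟩ := h
  have hne : i ≠ j := hij.ne
  have hp : S.toList.Perm (((S.erase i).erase j).toList ++ [i, j]) := by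
    rw [List.perm_ext_iff_of_nodup (Finset.nodup_toList S)]
    · intro a
      simp only [Finset.mem_toList, List.mem_append, Finset.mem_erase, List.mem_cons,
        List.not_mem_nil, or_false]
      by_cases h1 : a = i
      · subst h1; simp [hi]
      · by_cases h2 : a = j
        · subst h2; simp [hj]
        · simp [h1, h2]
    · rw [List.nodup_append]
      refine ⟨Finset.nodup_toList _, by simp [hne], ?_⟩
      intro a ha b hb
      simp only [Finset.mem_toList, Finset.mem_erase, List.mem_cons,
        List.not_mem_nil, or_false] at ha hb
      rcases hb with rfl | rfl
      · exact ha.2.1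
      · exact ha.1
  have hm : mon K (((S.erase i).erase j).toList ++ [i, j]) ∈ edgeIdeal K G := by
    rw [mon_append]
    apply Ideal.mul_mem_left
    apply Ideal.subset_span
    exact ⟨i, j, hij, by simp [mon, ee]⟩
  rcases mon_perm (K := K) hp with h | h <;> rw [h]
  · exact hm
  · exact neg_mem hm

theorem span_mon : Submodule.span K (Set.range fun S : Finset (Fin n) => mon K S.toList) = ⊤ := by
  rw [eq_top_iff]
  rintro x -
  induction x using CliffordAlgebra.left_induction with
  | algebraMap r =>
    rw [Algebra.algebraMap_eq_smul_one]
    exact Submodule.smul_mem _ _ (Submodule.subset_span ⟨∅, by simp [mon]⟩)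
  | add x y hx hy => exact add_mem hx hy
  | ι_mul x m hx =>
    have hm : CliffordAlgebra.ι (0 : QuadraticForm K (Fin n → K)) m = ∑ i, m i • ee K i := by
      change ExteriorAlgebra.ι K m = _
      conv_lhs => rw [pi_eq_sum_univ' m, map_sum]
      simp only [map_smul]
      refine Finset.sum_congr rfl fun i _ => ?_
      rw [ee]
    rw [hm, Finset.sum_mul]
    refine sum_mem fun i _ => ?_
    rw [smul_mul_assoc]
    refine Submodule.smul_mem _ _ ?_
    refine Submodule.span_induction (p := fun x _ => ee K i * x ∈ Submodule.span K (Set.range fun S : Finset (Fin n) => mon K S.toList)) ?_ ?_ ?_ ?_ hx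
    · rintro _ ⟨S, rfl⟩
      simp only
      by_cases hi : i ∈ S
      · have hp : S.toList.Perm (i :: (S.erase i).toList) := by
          rw [← Finset.insert_erase hi]
          convert Finset.toList_insert (Finset.notMem_erase i S) using 3
          simp
        have : ee K i * mon K S.toList = 0 := by
          rcases mon_perm (K := K) hp with h | h <;>
            simp [h, mon_cons, ← mul_assoc, ee_sq]
        rw [this]; exact zero_mem _
      · rw [← mon_cons]
        have hm : mon K (insert i S).toList ∈ Submodule.span K (Set.range fun S : Finset (Fin n) => mon K S.toList) :=
          Submodule.subset_span ⟨_, rfl⟩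
        rcases mon_perm (K := K) (Finset.toList_insert hi).symm with h | h <;> rw [h]
        · exact hm
        · exact neg_mem hm
    · simp
    · intro x y _ _ h1 h2
      rw [mul_add]; exact add_mem h1 h2
    · intro a x _ h
      rw [mul_smul_comm]; exact Submodule.smul_mem _ _ h

noncomputable abbrev EI (K : Type*) [Field K] : Submodule K (ExteriorAlgebra K (Fin n → K)) :=
  (edgeIdeal K G).restrictScalars K

abbrev QM (K : Type*) [Field K] := ExteriorAlgebra K (Fin n → K) ⧸ EI G K

noncomputable def bb (K : Type*) [Field K] (S : {S : Finset (Fin n) // GInd G S}) : QM G K :=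
  (EI G K).mkQ (mon K S.1.toList)

theorem ev_le : EI G K ≤ LinearMap.ker (ev G K) :=
  fun x hx => LinearMap.mem_ker.2 (ev_edge G x hx)

theorem mulLeft_le (v : Fin n → K) :
    EI G K ≤ (EI G K).comap (LinearMap.mulLeft K (ExteriorAlgebra.ι K v)) :=
  fun _ hx => Ideal.mul_mem_left (edgeIdeal K G) _ hx

theorem bb_li : LinearIndependent K (bb G K) := by
  have h : ∀ S : {S : Finset (Fin n) // GInd G S}, ∃ c : Kˣ,
      ev G K (mon K S.1.toList) = c • Finsupp.single S.1 (1 : K) := by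
    intro S
    obtain ⟨c, hc, h⟩ := ev_mon (K := K) G S.1.toList (Finset.nodup_toList _) (by simpa using S.2)
    refine ⟨Units.mk0 c hc, ?_⟩
    rw [h]
    simp [Units.smul_def]
  choose c hc using h
  apply LinearIndependent.of_comp ((EI G K).liftQ (ev G K) (ev_le G))
  have : (⇑((EI G K).liftQ (ev G K) (ev_le G)) ∘ bb G K) =
      c • (fun S : {S : Finset (Fin n) // GInd G S} => Finsupp.single S.1 (1 : K)) := by
    funext S
    simp only [Function.comp_apply, bb, Submodule.mkQ_apply, Submodule.liftQ_apply, hc]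
    rfl
  rw [this]
  apply LinearIndependent.units_smul
  exact (Finsupp.linearIndependent_single_one K (Finset (Fin n))).comp _ Subtype.val_injective

theorem bb_span : ⊤ ≤ Submodule.span K (Set.range (bb G K)) := by
  rintro x -
  obtain ⟨x, rfl⟩ := (EI G K).mkQ_surjective x
  have hx : x ∈ Submodule.span K (Set.range fun S : Finset (Fin n) => mon K S.toList) := by
    rw [span_mon]; trivial
  refine Submodule.span_induction (p := fun x _ => (EI G K).mkQ x ∈ Submodule.span K (Set.range (bb G K))) ?_ ?_ ?_ ?_ hx
  · rintro _ ⟨S, rfl⟩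
    by_cases hS : GInd G S
    · exact Submodule.subset_span ⟨⟨S, hS⟩, rfl⟩
    · have : (EI G K).mkQ (mon K S.toList) = 0 := by
        rw [Submodule.mkQ_apply, Submodule.Quotient.mk_eq_zero]
        exact mon_mem G S hS
      simp only [this]; exact zero_mem _
  · simp
  · intro x y _ _ h1 h2
    rw [map_add]; exact add_mem h1 h2
  · intro a x _ h
    rw [map_smul]; exact Submodule.smul_mem _ _ h

noncomputable def BB (K : Type*) [Field K] : Module.Basis {S : Finset (Fin n) // GInd G S} K (QM G K) :=
  Module.Basis.mk (bb_li G) (bb_span G)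

noncomputable def inv (K : Type*) [Field K] (n : ℕ) :
    ExteriorAlgebra K (Fin n → K) →ₐ[K] ExteriorAlgebra K (Fin n → K) :=
  CliffordAlgebra.involute

theorem inv_ι (v : Fin n → K) : inv K n (ExteriorAlgebra.ι K v) = - ExteriorAlgebra.ι K v :=
  CliffordAlgebra.involute_ι v

theorem inv_mon (l : List (Fin n)) : inv K n (mon K l) = (-1 : K) ^ l.length • mon K l := by
  induction l with
  | nil => simp [mon]
  | cons i l ih =>
    rw [mon_cons, map_mul, ih, ee, inv_ι, List.length_cons, pow_succ]
    simp

theorem inv_mem : EI G K ≤ (EI G K).comap (inv K n).toLinearMap := by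
  intro x hx
  change x ∈ edgeIdeal K G at hx
  change inv K n x ∈ edgeIdeal K G
  unfold edgeIdeal at hx
  refine Submodule.span_induction ?_ ?_ ?_ ?_ hx
  · rintro _ ⟨i, j, hij, rfl⟩
    rw [map_mul, inv_ι, inv_ι, neg_mul_neg]
    exact Ideal.subset_span ⟨i, j, hij, rfl⟩
  · simp
  · intro x y _ _ h1 h2
    rw [map_add]; exact add_mem h1 h2
  · intro a x _ h
    rw [smul_eq_mul, map_mul]
    exact Ideal.mul_mem_left _ _ h

noncomputable def sig (K : Type*) [Field K] : QM G K →ₗ[K] QM G K :=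
  (EI G K).mapQ (EI G K) (inv K n).toLinearMap (inv_mem G)

noncomputable def TT (v : Fin n → K) : QM G K →ₗ[K] QM G K :=
  (EI G K).mapQ (EI G K) (LinearMap.mulLeft K (ExteriorAlgebra.ι K v)) (mulLeft_le G v)

theorem sig_TT (v : Fin n → K) : sig G K ∘ₗ TT G v = - (TT G v ∘ₗ sig G K) := by
  refine LinearMap.ext fun x => ?_
  obtain ⟨x, rfl⟩ := (EI G K).mkQ_surjective x
  simp only [sig, TT, LinearMap.comp_apply, Submodule.mkQ_apply, Submodule.mapQ_apply,
    LinearMap.neg_apply, LinearMap.mulLeft_apply, AlgHom.toLinearMap_apply, map_mul, inv_ι, neg_mul,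
    Submodule.Quotient.mk_neg]

open Classical in
theorem trace_sig : LinearMap.trace K _ (sig G K) =
    ∑ S : {S : Finset (Fin n) // GInd G S}, (-1 : K) ^ S.1.card := by
  rw [LinearMap.trace_eq_matrix_trace K (BB G K), Matrix.trace]
  refine Finset.sum_congr rfl fun S _ => ?_
  have : sig G K (BB G K S) = (-1 : K) ^ S.1.card • BB G K S := by
    rw [BB, Module.Basis.mk_apply, bb, sig, Submodule.mkQ_apply, Submodule.mapQ_apply,
      AlgHom.toLinearMap_apply, inv_mon, Finset.length_toList, Submodule.Quotient.mk_smul]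
  rw [Matrix.diag_apply, LinearMap.toMatrix_apply, this]
  simp

end Model

open Classical in
theorem sum_eq_FF (K : Type*) [Field K] (n : ℕ) :
    ∑ S : {S : Finset (Fin n) // GInd (SimpleGraph.pathGraph n) S}, (-1 : K) ^ S.1.card
      = (FF n : K) := by
  have hr : Finset.range n = (Finset.univ : Finset (Fin n)).map Fin.valEmbedding := by
    ext a
    simp only [Finset.mem_range, Finset.mem_map, Finset.mem_univ, true_and, Fin.valEmbedding_apply]
    exact ⟨fun h => ⟨⟨a, h⟩, rfl⟩, fun ⟨b, h⟩ => h ▸ b.2⟩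
  have hI : ∀ S : Finset (Fin n), Ind (S.map Fin.valEmbedding) ↔ GInd (SimpleGraph.pathGraph n) S := by
    intro S
    unfold Ind GInd
    constructor
    · intro h i hi j hj hij
      rw [SimpleGraph.pathGraph_adj] at hij
      rcases hij with hij | hij
      · exact h i (Finset.mem_map_of_mem _ hi) (hij ▸ Finset.mem_map_of_mem _ hj)
      · exact h j (Finset.mem_map_of_mem _ hj) (hij ▸ Finset.mem_map_of_mem _ hi)
    · intro h a ha hb
      obtain ⟨i, hi, rfl⟩ := Finset.mem_map.1 ha
      obtain ⟨j, hj, hij⟩ := Finset.mem_map.1 hb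
      exact h i hi j hj (SimpleGraph.pathGraph_adj.2 (Or.inl hij.symm))
  have h1 : FF n = ∑ S : Finset (Fin n), wt (S.map Fin.valEmbedding) := by
    unfold FF
    symm
    apply Finset.sum_bij (fun S _ => S.map Fin.valEmbedding)
    · intro S _
      rw [Finset.mem_powerset, hr]
      exact Finset.map_subset_map.2 (Finset.subset_univ _)
    · intro S _ T _ h
      exact Finset.map_injective _ h
    · intro T hT
      rw [Finset.mem_powerset, hr, Finset.subset_map_iff] at hT
      obtain ⟨u, _, rfl⟩ := hT
      exact ⟨u, Finset.mem_univ _, rfl⟩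
    · intros; rfl
  rw [h1]
  unfold wt
  simp only [hI, Finset.card_map]
  push_cast
  rw [← Finset.sum_filter]
  symm
  rw [Finset.sum_subtype (p := fun S => GInd (SimpleGraph.pathGraph n) S) _ (by simp)]

/-- Let `E` be the exterior algebra on `n` variables over an infinite field and `Pₙ` the
path graph on `n` vertices.  If `n ≢ 1 (mod 3)`, then `E/I_E(Pₙ)` has no regular linear
form: every degree-one element `ι v` of `E` is singular on `E/I_E(Pₙ)`. -/
theorem stmt9 (K : Type*) [Field K] [Infinite K] (n : ℕ) (hn : n % 3 ≠ 1) (v : Fin n → K) :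
    ¬ ({m : ExteriorAlgebra K (Fin n → K) ⧸ edgeIdeal K (SimpleGraph.pathGraph n) |
          (ExteriorAlgebra.ι K v : ExteriorAlgebra K (Fin n → K)) • m = 0} =
        Set.range
          fun m : ExteriorAlgebra K (Fin n → K) ⧸ edgeIdeal K (SimpleGraph.pathGraph n) =>
            (ExteriorAlgebra.ι K v : ExteriorAlgebra K (Fin n → K)) • m) := by
  classical
  intro heq
  set G := SimpleGraph.pathGraph n
  have hT : ∀ x, TT G v x = 0 ↔ ∃ y, TT G v y = x := by
    intro x
    obtain ⟨x, rfl⟩ := (EI G K).mkQ_surjective x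
    have h := Set.ext_iff.1 heq ((edgeIdeal K G).mkQ x)
    rw [Set.mem_ofPred_eq, Set.mem_range] at h
    have e1 : TT G v ((EI G K).mkQ x) = 0 ↔
        (ExteriorAlgebra.ι K v) • (edgeIdeal K G).mkQ x = 0 := by
      rw [← map_smul, Submodule.mkQ_apply, Submodule.mkQ_apply, Submodule.Quotient.mk_eq_zero,
        TT, Submodule.mapQ_apply, Submodule.Quotient.mk_eq_zero]
      rfl
    rw [e1, h]
    constructor
    · rintro ⟨y, hy⟩
      obtain ⟨y, rfl⟩ := (edgeIdeal K G).mkQ_surjective y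
      rw [← map_smul, Submodule.mkQ_apply, Submodule.mkQ_apply, Submodule.Quotient.eq] at hy
      refine ⟨(EI G K).mkQ y, ?_⟩
      rw [Submodule.mkQ_apply, Submodule.mkQ_apply, TT, Submodule.mapQ_apply, Submodule.Quotient.eq]
      exact hy
    · rintro ⟨y, hy⟩
      obtain ⟨y, rfl⟩ := (EI G K).mkQ_surjective y
      rw [Submodule.mkQ_apply, Submodule.mkQ_apply, TT, Submodule.mapQ_apply,
        Submodule.Quotient.eq] at hy
      refine ⟨(edgeIdeal K G).mkQ y, ?_⟩
      rw [← map_smul, Submodule.mkQ_apply, Submodule.mkQ_apply, Submodule.Quotient.eq]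
      exact hy
  haveI : FiniteDimensional K (QM G K) := Module.Finite.of_basis (BB G K)
  have h0 := trace_zero (TT G v) (sig G K) (sig_TT G v) hT
  rw [trace_sig, sum_eq_FF] at h0
  rcases FF_ne n hn with h | h <;> rw [h] at h0 <;> simp at h0
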